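/- Let $\Gamma$ be a compact connected subset of the open unit square $\mathrm{Int}(\mathcal{Q})$, $\mathcal{Q} = [0,1]^2$, such that $\mathcal{Q} \setminus \Gamma$ is connected. Then for every $\varepsilon > 0$ there exists a $C^1$, closed, injective curve $\theta : \mathbb{S}^1 \to \mathrm{Int}(\mathcal{Q})$ such that $\Gamma$ is contained in the bounded component of the complement of $\theta$ (the 'internal part' of $\theta$), and $\mathrm{dist}(\theta(s), \Gamma) < \varepsilon$ for every $s \in \mathbb{S}^1$. -/

import Mathlib

open Set Metric

noncomputable def Qsq : Set (ℝ × ℝ) := Icc (0:ℝ) 1 ×ˢ Icc (0:ℝ) 1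

namespace JC

abbrev V := ℤ × ℤ
abbrev E := (ℤ × ℤ) × Bool

def dst (e : E) : V := if e.2 then (e.1.1, e.1.2 + 1) else (e.1.1 + 1, e.1.2)
def opp (e : E) : V := if e.2 then (e.1.1 - 1, e.1.2) else (e.1.1, e.1.2 - 1)
def d (f : V → ZMod 2) (e : E) : ZMod 2 := f e.1 + f (opp e)
def Joins (e : E) (u v : V) : Prop := (u = e.1 ∧ v = dst e) ∨ (v = e.1 ∧ u = dst e)
def cell (c : V) : Set (ℝ × ℝ) :=
  {x | ((c.1 : ℝ) ≤ x.1 ∧ x.1 ≤ c.1 + 1) ∧ ((c.2 : ℝ) ≤ x.2 ∧ x.2 ≤ c.2 + 1)}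

lemma exists_cycle {W : Type*} (R : W → W → Prop) (irr : ∀ u v, R u v → u ≠ v)
    (ext : ∀ u v, R u v → ∃ w, w ≠ u ∧ R v w) (fin : {v | ∃ u, R u v}.Finite)
    (u0 v0 : W) (h0 : R u0 v0) :
    ∃ (n : ℕ) (p : ℕ → W), 3 ≤ n ∧ p n = p 0 ∧ (∀ i < n, ∀ j < n, p i = p j → i = j) ∧
      ∀ k, R (p k) (p (k + 1)) := by
  classical
  choose! nx hnx1 hnx2 using ext
  let T := {q : W × W // R q.1 q.2}
  let step : T → T := fun q => ⟨(q.1.2, nx q.1.1 q.1.2), hnx2 _ _ q.2⟩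
  let s : ℕ → T := fun k => step^[k] ⟨(u0, v0), h0⟩
  have hs : ∀ k, s (k + 1) = step (s k) := fun k => Function.iterate_succ_apply' _ _ _
  let v : ℕ → W := fun k => (s k).1.2
  have hv1 : ∀ k, (s (k + 1)).1.1 = v k := fun k => by rw [hs]
  have hR : ∀ k, R (v k) (v (k + 1)) := fun k => by
    have := (s (k + 1)).2
    rw [hv1] at this
    exact this
  have hnb : ∀ k, v (k + 2) ≠ v k := fun k => by
    have h1 : v (k + 2) = nx (s (k+1)).1.1 (s (k+1)).1.2 := by
      show (s (k + 1 + 1)).1.2 = _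
      rw [hs]
    rw [h1, ← hv1]
    exact hnx1 _ _ (s (k + 1)).2
  have hrep : ∃ g, 0 < g ∧ ∃ m, v m = v (m + g) := by
    have : ¬ Function.Injective v := fun hi => by
      have : (range v).Finite := fin.subset (by
        rintro _ ⟨k, rfl⟩
        exact ⟨_, (s k).2⟩)
      exact (Set.infinite_range_of_injective hi) this
    simp only [Function.Injective, not_forall] at this
    obtain ⟨a, b, hab, hne⟩ := this
    rcases lt_or_gt_of_ne hne with h | h
    · exact ⟨b - a, by omega, a, by rw [hab]; congr 1; omega⟩
    · exact ⟨a - b, by omega, b, by rw [← hab]; congr 1; omega⟩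
  obtain ⟨hg, m, hm⟩ := Nat.find_spec hrep
  set g := Nat.find hrep with hgdef
  have hmin : ∀ a b, a < b → b < a + g → v a ≠ v b := fun a b hab hb he => by
    refine Nat.find_min hrep (m := b - a) (by omega) ⟨by omega, a, ?_⟩
    rw [he]; congr 1; omega
  refine ⟨g, fun k => v (m + k), ?_, hm.symm, ?_, fun k => hR _⟩
  · have h1 : g ≠ 1 := fun h => irr _ _ (hR m) (by rw [hm, h])
    have h2 : g ≠ 2 := fun h => hnb m (by rw [hm, h])
    omega
  · intro i hi j hj hij
    by_contra hne
    rcases lt_or_gt_of_ne hne with h | h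
    · exact hmin _ _ (by omega) (by omega) hij
    · exact hmin (m + j) (m + i) (by omega) (by omega) hij.symm

open Classical in
noncomputable def ind (e : E) (u v : V) : ZMod 2 := if Joins e u v then 1 else 0

def w (c u v : V) : ZMod 2 :=
  if u.1 = v.1 ∧ u.1 ≤ c.1 then (if u.2 ≤ c.2 then 1 else 0) + (if v.2 ≤ c.2 then 1 else 0) else 0

lemma two_eq : (1 : ZMod 2) + 1 = 0 := by decide

lemma w_vert (i j : ℤ) (u v : V) (h : ∃ e, Joins e u v) :
    w (i, j) u v + w (i - 1, j) u v = ind ((i, j), true) u v := by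
  obtain ⟨⟨⟨a, b⟩, t⟩, h⟩ := h
  obtain ⟨u1, u2⟩ := u
  obtain ⟨v1, v2⟩ := v
  cases t <;> simp only [Joins, dst, w, ind, Prod.mk.injEq, if_true, Bool.false_eq_true, if_false] at h ⊢ <;>
  split_ifs <;> first | omega | decide

lemma w_hor (i j : ℤ) (u v : V) (h : ∃ e, Joins e u v) :
    w (i, j) u v + w (i, j - 1) u v = ind ((i, j), false) u v +
      ((if u.2 = j ∧ u.1 ≤ i then 1 else 0) + (if v.2 = j ∧ v.1 ≤ i then 1 else 0)) := by
  obtain ⟨⟨⟨a, b⟩, t⟩, h⟩ := h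
  obtain ⟨u1, u2⟩ := u
  obtain ⟨v1, v2⟩ := v
  cases t <;> simp only [Joins, dst, w, ind, Prod.mk.injEq, if_true, Bool.false_eq_true, if_false] at h ⊢ <;>
  split_ifs <;> first | omega | decide

lemma tele (n : ℕ) (r : ℕ → ZMod 2) (h : r n = r 0) :
    ∑ k ∈ Finset.range n, (r k + r (k + 1)) = 0 := by
  have h1 : ∀ k, r k + r (k + 1) = r (k + 1) - r k := fun k => by
    generalize r k = a; generalize r (k+1) = b; revert a b; decide
  simp only [h1, Finset.sum_range_sub, h, sub_self]

lemma cyc_fill (n : ℕ) (p : ℕ → V) (hp : p n = p 0)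
    (hj : ∀ k, ∃ e, Joins e (p k) (p (k + 1))) :
    ∃ g : V → ZMod 2, {c | g c ≠ 0}.Finite ∧
      ∀ e, d g e = ∑ k ∈ Finset.range n, ind e (p k) (p (k + 1)) := by
  refine ⟨fun c => ∑ k ∈ Finset.range n, w c (p k) (p (k + 1)), ?_, ?_⟩
  · obtain ⟨M, hM⟩ : ∃ M : ℤ, ∀ k ∈ Finset.range (n + 1), |(p k).1| ≤ M ∧ |(p k).2| ≤ M := by
      refine ⟨∑ k ∈ Finset.range (n + 1), (|(p k).1| + |(p k).2|), fun k hk => ?_⟩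
      have := Finset.single_le_sum (f := fun k => |(p k).1| + |(p k).2|)
        (fun i _ => by positivity) hk
      have h1 := abs_nonneg (p k).1
      have h2 := abs_nonneg (p k).2
      constructor <;> linarith
    have hM1 : ∀ k ∈ Finset.range n, |(p k).1| ≤ M ∧ |(p k).2| ≤ M := fun k hk =>
      hM k (by simp at hk ⊢; omega)
    have hM2 : ∀ k ∈ Finset.range n, |(p (k+1)).1| ≤ M ∧ |(p (k+1)).2| ≤ M := fun k hk =>
      hM (k+1) (by simp at hk ⊢; omega)
    refine ((Set.finite_Icc (-M) M).prod (Set.finite_Icc (-M) M)).subset ?_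
    rintro ⟨i, j⟩ hc
    by_contra hout
    apply hc
    simp only [mem_prod, mem_Icc] at hout
    by_cases hi : i < -M
    · apply Finset.sum_eq_zero
      intro k hk
      have := hM1 k hk
      simp only [abs_le] at this
      simp only [w]
      rw [if_neg]; omega
    by_cases hj1 : j < -M
    · apply Finset.sum_eq_zero
      intro k hk
      have := hM1 k hk
      have h2 := hM2 k hk
      simp only [abs_le] at this h2
      simp only [w]
      split_ifs <;> first | omega | decide
    by_cases hj2 : M < j
    · apply Finset.sum_eq_zero
      intro k hk
      have := hM1 k hk
      have h2 := hM2 k hk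
      simp only [abs_le] at this h2
      simp only [w]
      split_ifs <;> first | omega | decide
    have hi2 : M < i := by omega
    rw [← tele n (fun k => if (p k).2 ≤ j then 1 else 0) (by simp only [hp])]
    apply Finset.sum_congr rfl
    intro k hk
    have := hM1 k hk
    have h2 := hM2 k hk
    obtain ⟨⟨⟨a, b⟩, t⟩, h⟩ := hj k
    simp only [abs_le] at this h2
    simp only [w]
    generalize p k = u at *
    generalize p (k + 1) = v at *
    obtain ⟨u1, u2⟩ := u
    obtain ⟨v1, v2⟩ := v
    cases t <;> simp only [Joins, dst, Prod.mk.injEq, if_true, Bool.false_eq_true, if_false] at * <;>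
    split_ifs <;> first | omega | decide
  · rintro ⟨⟨i, j⟩, t⟩
    cases t
    · simp only [d, opp, Bool.false_eq_true, if_false]
      rw [← Finset.sum_add_distrib, Finset.sum_congr rfl (fun k _ => w_hor i j _ _ (hj k)),
        Finset.sum_add_distrib,
        tele n (fun k => if (p k).2 = j ∧ (p k).1 ≤ i then 1 else 0) (by simp only [hp]), add_zero]
    · simp only [d, opp, if_true]
      rw [← Finset.sum_add_distrib, Finset.sum_congr rfl (fun k _ => w_vert i j _ _ (hj k))]

lemma d_finite (f : V → ZMod 2) (hf : {c | f c ≠ 0}.Finite) : {e | d f e ≠ 0}.Finite := by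
  refine ((hf.prod (Set.finite_univ (α := Bool))).union
    ((hf.image (fun c : V => (((c.1 + 1, c.2), true) : E))).union
      (hf.image (fun c : V => (((c.1, c.2 + 1), false) : E))))).subset ?_
  rintro ⟨⟨i, j⟩, t⟩ he
  by_cases h0 : f (i, j) = 0
  · right
    simp only [d, h0, zero_add, mem_ofPred_eq] at he
    cases t
    · exact Or.inr ⟨_, he, by simp [opp]⟩
    · exact Or.inl ⟨_, he, by simp [opp]⟩
  · exact Or.inl ⟨h0, trivial⟩

def Adj (f : V → ZMod 2) (u v : V) : Prop := ∃ e, d f e ≠ 0 ∧ Joins e u v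

lemma Adj_ext (f : V → ZMod 2) (u v : V) (h : Adj f u v) : ∃ x, x ≠ u ∧ Adj f v x := by
  obtain ⟨i, j⟩ := v
  have key : d f ((i, j), true) + d f ((i, j - 1), true) + d f ((i, j), false) +
      d f ((i - 1, j), false) = 0 := by
    simp only [d, opp, if_true, Bool.false_eq_true, if_false]
    generalize f (i, j) = a
    generalize f (i - 1, j) = b
    generalize f (i, j - 1) = c
    generalize f (i - 1, j - 1) = d
    revert a b c d
    decide
  have a1 : d f ((i, j), true) ≠ 0 → Adj f (i, j) (i, j + 1) := fun h =>
    ⟨_, h, Or.inl ⟨rfl, by simp [dst]⟩⟩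
  have a2 : d f ((i, j - 1), true) ≠ 0 → Adj f (i, j) (i, j - 1) := fun h =>
    ⟨_, h, Or.inr ⟨rfl, by simp [dst]⟩⟩
  have a3 : d f ((i, j), false) ≠ 0 → Adj f (i, j) (i + 1, j) := fun h =>
    ⟨_, h, Or.inl ⟨rfl, by simp [dst]⟩⟩
  have a4 : d f ((i - 1, j), false) ≠ 0 → Adj f (i, j) (i - 1, j) := fun h =>
    ⟨_, h, Or.inr ⟨rfl, by simp [dst]⟩⟩
  by_contra hcon
  push Not at hcon
  have hz : ∀ z : V, z ≠ u → ¬ Adj f (i, j) z := hcon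
  have b1 : u ≠ (i, j + 1) → d f ((i, j), true) = 0 := fun h => by
    by_contra h'; exact hz _ h.symm (a1 h')
  have b2 : u ≠ (i, j - 1) → d f ((i, j - 1), true) = 0 := fun h => by
    by_contra h'; exact hz _ h.symm (a2 h')
  have b3 : u ≠ (i + 1, j) → d f ((i, j), false) = 0 := fun h => by
    by_contra h'; exact hz _ h.symm (a3 h')
  have b4 : u ≠ (i - 1, j) → d f ((i - 1, j), false) = 0 := fun h => by
    by_contra h'; exact hz _ h.symm (a4 h')
  obtain ⟨⟨⟨a, b⟩, t⟩, hd, h⟩ := h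
  obtain ⟨u1, u2⟩ := u
  cases t <;> simp only [Joins, dst, Prod.mk.injEq, if_true, Bool.false_eq_true, if_false, ne_eq] at h b1 b2 b3 b4
  · rcases h with ⟨⟨rfl, rfl⟩, rfl, rfl⟩ | ⟨⟨rfl, rfl⟩, rfl, rfl⟩
    · rw [b1 (by omega), b2 (by omega), b3 (by omega)] at key
      apply hd; simpa using key
    · rw [b1 (by omega), b2 (by omega), b4 (by omega)] at key
      apply hd; simpa using key
  · rcases h with ⟨⟨rfl, rfl⟩, rfl, rfl⟩ | ⟨⟨rfl, rfl⟩, rfl, rfl⟩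
    · rw [b1 (by omega), b3 (by omega), b4 (by omega)] at key
      apply hd; simpa using key
    · rw [b2 (by omega), b3 (by omega), b4 (by omega)] at key
      apply hd; simpa using key


lemma Joins_ne (e : E) (u v : V) (h : Joins e u v) : u ≠ v := by
  obtain ⟨⟨a, b⟩, t⟩ := e
  obtain ⟨u1, u2⟩ := u
  obtain ⟨v1, v2⟩ := v
  cases t <;> simp only [Joins, dst, Prod.mk.injEq, if_true, Bool.false_eq_true, if_false, ne_eq] at h ⊢ <;> omega

lemma Joins_eq (e e' : E) (u v : V) (h : Joins e u v) (h' : Joins e' u v) : e = e' := by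
  obtain ⟨⟨a, b⟩, t⟩ := e
  obtain ⟨⟨a', b'⟩, t'⟩ := e'
  obtain ⟨u1, u2⟩ := u
  obtain ⟨v1, v2⟩ := v
  cases t <;> cases t' <;> simp only [Joins, dst, Prod.mk.injEq, if_true, Bool.false_eq_true, if_false, ne_eq, reduceCtorEq, and_true, and_false] at h h' ⊢ <;> omega

lemma Joins_pair (e : E) (u v u' v' : V) (h : Joins e u v) (h' : Joins e u' v') :
    (u = u' ∧ v = v') ∨ (u = v' ∧ v = u') := by
  rcases h with ⟨rfl, rfl⟩ | ⟨rfl, rfl⟩ <;> rcases h' with ⟨rfl, rfl⟩ | ⟨rfl, rfl⟩ <;> simp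

lemma exists_d_ne (f : V → ZMod 2) (hf : {c | f c ≠ 0}.Finite) (c : V) (hc : f c ≠ 0) :
    ∃ e, d f e ≠ 0 := by
  by_contra hcon
  push Not at hcon
  have h : ∀ k : ℕ, f (c.1 + k, c.2) = f c := by
    intro k
    induction k with
    | zero => simp
    | succ k ih =>
      have := hcon ((c.1 + (k + 1 : ℕ), c.2), true)
      simp only [d, opp, if_true] at this
      rw [show c.1 + ((k + 1 : ℕ) : ℤ) - 1 = c.1 + k by push_cast; ring, ih] at this
      generalize f (c.1 + ((k + 1 : ℕ) : ℤ), c.2) = a at *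
      generalize f c = b at *
      clear ih hc
      revert a b; decide
  refine Set.infinite_of_injective_forall_mem (f := fun k : ℕ => ((c.1 + k, c.2) : V)) ?_ ?_ hf
  · intro a b hab
    simpa using hab
  · intro k
    simpa [h k] using hc

/-- A simple closed lattice cycle inside `∂f` enclosing `c0`. -/
lemma exists_enclosing (N : ℕ) : ∀ (f : V → ZMod 2) (_ : {c | f c ≠ 0}.Finite) (c0 : V)
    (_ : f c0 ≠ 0) (_ : {e | d f e ≠ 0}.ncard ≤ N),
    ∃ (n : ℕ) (p : ℕ → V) (g : V → ZMod 2), 3 ≤ n ∧ p n = p 0 ∧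
      (∀ i < n, ∀ j < n, p i = p j → i = j) ∧ (∀ k, Adj f (p k) (p (k + 1))) ∧
      {c | g c ≠ 0}.Finite ∧ g c0 ≠ 0 ∧
      ∀ e, d g e ≠ 0 → ∃ k < n, Joins e (p k) (p (k + 1)) := by
  induction N with
  | zero =>
    intro f hf c0 hc0 hN
    obtain ⟨e, he⟩ := exists_d_ne f hf c0 hc0
    have := (Set.ncard_eq_zero (d_finite f hf)).1 (by omega)
    have h2 : e ∈ {e | d f e ≠ 0} := he
    rw [this] at h2
    exact h2.elim
  | succ N ih =>
    intro f hf c0 hc0 hN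
    obtain ⟨e0, he0⟩ := exists_d_ne f hf c0 hc0
    obtain ⟨n, p, hn, hp, hinj, hadj⟩ := exists_cycle (Adj f)
      (fun u v ⟨e, _, h⟩ => Joins_ne e u v h) (Adj_ext f)
      (by
        refine (((d_finite f hf).image (fun e => e.1)).union
          ((d_finite f hf).image dst)).subset ?_
        rintro v ⟨u, e, he, ⟨h1, h2⟩ | ⟨h1, h2⟩⟩
        · exact Or.inr ⟨e, he, h2.symm⟩
        · exact Or.inl ⟨e, he, h1.symm⟩) e0.1 (dst e0) ⟨e0, he0, Or.inl ⟨rfl, rfl⟩⟩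
    obtain ⟨g, hgf, hg⟩ := cyc_fill n p hp (fun k => let ⟨e, _, h⟩ := hadj k; ⟨e, h⟩)
    have hgC : ∀ e, d g e ≠ 0 → ∃ k < n, Joins e (p k) (p (k + 1)) := by
      intro e he
      rw [hg] at he
      obtain ⟨k, hk, h⟩ := Finset.exists_ne_zero_of_sum_ne_zero he
      refine ⟨k, by simpa using hk, ?_⟩
      by_contra h'
      exact h (by simp [ind, h'])
    by_cases hgc : g c0 = 0
    · have hdadd : ∀ e, d (f + g) e = d f e + d g e := fun e => by
        simp only [d, Pi.add_apply]; ring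
      have hsub : {e | d (f + g) e ≠ 0} ⊆ {e | d f e ≠ 0} := by
        intro e he
        by_cases h : d g e = 0
        · simpa [hdadd, h] using he
        · obtain ⟨k, _, hk⟩ := hgC e h
          obtain ⟨e', he', hj'⟩ := hadj k
          rw [Joins_eq _ _ _ _ hk hj']
          exact he'
      obtain ⟨e1, he1, hj1⟩ := hadj 0
      have hone : d g e1 = 1 := by
        rw [hg, Finset.sum_eq_single 0]
        · simp only [ind]; rw [if_pos hj1]
        · intro k hk hk0
          simp only [ind]
          rw [if_neg]
          intro hjk
          have hk : k < n := by simpa using hk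
          rcases Joins_pair _ _ _ _ _ hjk hj1 with ⟨h, _⟩ | ⟨h, h'⟩
          · exact hk0 (hinj _ hk _ (by omega) h)
          · have := hinj _ hk 1 (by omega) h
            subst this
            have := hinj 2 (by omega) 0 (by omega) h'
            omega
        · intro h; simp at h; omega
      have hlt : {e | d (f + g) e ≠ 0}.ncard < {e | d f e ≠ 0}.ncard := by
        apply Set.ncard_lt_ncard _ (d_finite f hf)
        refine ⟨hsub, fun h => ?_⟩
        have := h he1
        simp only [mem_ofPred_eq, hdadd, hone] at this
        generalize d f e1 = a at *
        revert a; decide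
      have hfin : {c | (f + g) c ≠ 0}.Finite := (hf.union hgf).subset (by
        intro c hc
        by_contra h
        simp only [mem_union, mem_ofPred_eq, not_or, not_not] at h
        exact hc (by simp [h.1, h.2]))
      obtain ⟨n, p, g', h1, h2, h3, h4, h5, h6, h7⟩ := ih (f + g) hfin c0
        (by simpa [hgc] using hc0) (by omega)
      exact ⟨n, p, g', h1, h2, h3, fun k => let ⟨e, he, hj⟩ := h4 k; ⟨e, hsub he, hj⟩, h5, h6, h7⟩
    · exact ⟨n, p, g, hn, hp, hinj, hadj, hgf, hgc, hgC⟩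

/-- closed lattice edge -/
def seg (e : E) : Set (ℝ × ℝ) := cell e.1 ∩ cell (opp e)

lemma cell_eq (i i' : ℤ) (x : ℝ) (h : (i : ℝ) ≤ x ∧ x ≤ i + 1) (h' : (i' : ℝ) ≤ x ∧ x ≤ i' + 1) :
    i' = i ∨ i' = i - 1 ∨ i' = i + 1 := by
  have h1 : (i : ℝ) ≤ (i' + 1 : ℤ) := by push_cast; linarith
  have h2 : (i' : ℝ) ≤ (i + 1 : ℤ) := by push_cast; linarith
  have h1 := Int.cast_le.1 h1
  have h2 := Int.cast_le.1 h2
  omega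

lemma seg_of_cells (g : V → ZMod 2) (c c' : V) (x : ℝ × ℝ) (hc : x ∈ cell c) (hc' : x ∈ cell c')
    (h : g c ≠ g c') : ∃ e, d g e ≠ 0 ∧ x ∈ seg e := by
  have key : ∀ a b : ZMod 2, a ≠ b → a + b ≠ 0 := by decide
  obtain ⟨i, j⟩ := c
  obtain ⟨i', j'⟩ := c'
  have hm : x ∈ cell (i', j) := ⟨hc'.1, hc.2⟩
  by_cases h1 : g (i, j) = g (i', j)
  · rw [h1] at h
    rcases cell_eq j j' x.2 hc.2 hc'.2 with rfl | rfl | rfl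
    · exact absurd rfl h
    · exact ⟨((i', j), false), key _ _ h, hm, hc'⟩
    · refine ⟨((i', j + 1), false), ?_, hc', ?_⟩
      · simp only [d, opp, Bool.false_eq_true, if_false, add_sub_cancel_right]
        exact key _ _ h.symm
      · simpa [opp] using hm
  · rcases cell_eq i i' x.1 hc.1 hc'.1 with rfl | rfl | rfl
    · exact absurd rfl h1
    · exact ⟨((i, j), true), key _ _ h1, hc, hm⟩
    · refine ⟨((i + 1, j), true), ?_, hm, ?_⟩
      · simp only [d, opp, if_true, add_sub_cancel_right]
        exact key _ _ (Ne.symm h1)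
      · simpa [opp] using hc

lemma isClosed_cell (c : V) : IsClosed (cell c) := by
  have : cell c = Icc (c.1 : ℝ) (c.1 + 1) ×ˢ Icc (c.2 : ℝ) (c.2 + 1) := rfl
  rw [this]
  exact isClosed_Icc.prod isClosed_Icc

lemma isBounded_cell (c : V) : Bornology.IsBounded (cell c) := by
  have : cell c = Icc (c.1 : ℝ) (c.1 + 1) ×ˢ Icc (c.2 : ℝ) (c.2 + 1) := rfl
  rw [this]
  exact (isCompact_Icc.prod isCompact_Icc).isBounded

lemma dist_cell (c : V) (x y : ℝ × ℝ) (hx : x ∈ cell c) (hy : y ∈ cell c) : dist x y ≤ 1 := by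
  obtain ⟨⟨a, b⟩, a', b'⟩ := hx
  obtain ⟨⟨p, q⟩, p', q'⟩ := hy
  rw [Prod.dist_eq, Real.dist_eq, Real.dist_eq]
  exact max_le (abs_le.2 ⟨by linarith, by linarith⟩) (abs_le.2 ⟨by linarith, by linarith⟩)

lemma mem_cell_floor (x : ℝ × ℝ) : x ∈ cell (⌊x.1⌋, ⌊x.2⌋) :=
  ⟨⟨Int.floor_le _, (Int.lt_floor_add_one _).le⟩, ⟨Int.floor_le _, (Int.lt_floor_add_one _).le⟩⟩

lemma ev_floor (x : ℝ) : ∀ᶠ y : ℝ in nhds x, (⌊y⌋ : ℝ) ≤ x ∧ x ≤ ⌊y⌋ + 1 := by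
  have h1 : ∀ᶠ y : ℝ in nhds x, y < ⌊x⌋ + 1 := (gt_mem_nhds (Int.lt_floor_add_one x))
  have h2 : ∀ᶠ y : ℝ in nhds x, (⌈x⌉ : ℝ) - 1 < y :=
    lt_mem_nhds (by have := Int.ceil_lt_add_one x; linarith)
  filter_upwards [h1, h2] with y hy1 hy2
  constructor
  · have : ⌊y⌋ < ⌊x⌋ + 1 := Int.floor_lt.2 (by exact_mod_cast hy1)
    have : (⌊y⌋ : ℝ) ≤ ⌊x⌋ := by exact_mod_cast (by omega : ⌊y⌋ ≤ ⌊x⌋)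
    linarith [Int.floor_le x]
  · have : ⌈x⌉ - 1 ≤ ⌊y⌋ := Int.le_floor.2 (by push_cast; exact hy2.le)
    have : (⌈x⌉ : ℝ) - 1 ≤ ⌊y⌋ := by exact_mod_cast this
    linarith [Int.le_ceil x]

lemma frontier_sub (g : V → ZMod 2) (hg : {c | g c ≠ 0}.Finite) :
    frontier (⋃ c ∈ {c | g c ≠ 0}, cell c) ⊆ {x | ∃ e, d g e ≠ 0 ∧ x ∈ seg e} := by
  intro x hx
  have hcl : IsClosed (⋃ c ∈ {c | g c ≠ 0}, cell c) := hg.isClosed_biUnion fun c _ => isClosed_cell c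
  have hxA := hcl.frontier_subset hx
  simp only [mem_iUnion] at hxA
  obtain ⟨c, hc, hxc⟩ := hxA
  by_contra hcon
  have hall : ∀ c', x ∈ cell c' → g c' ≠ 0 := fun c' hc' h0 => by
    apply hcon
    apply seg_of_cells g c c' x hxc hc'
    rw [h0]; exact hc
  apply hx.2
  rw [mem_interior_iff_mem_nhds]
  have : ∀ᶠ y : ℝ × ℝ in nhds x, x ∈ cell (⌊y.1⌋, ⌊y.2⌋) :=
    ((continuous_fst.tendsto x).eventually (ev_floor x.1)).and
      ((continuous_snd.tendsto x).eventually (ev_floor x.2))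
  filter_upwards [this] with y hy
  simp only [mem_iUnion]
  exact ⟨_, hall _ hy, mem_cell_floor y⟩

lemma cells_finite (Γ : Set (ℝ × ℝ)) (h : Bornology.IsBounded Γ) :
    {c : V | (cell c ∩ Γ).Nonempty}.Finite := by
  obtain ⟨R, hR⟩ := h.subset_closedBall 0
  refine ((Set.finite_Icc (-⌈R⌉ - 1) ⌈R⌉).prod (Set.finite_Icc (-⌈R⌉ - 1) ⌈R⌉)).subset ?_
  rintro ⟨i, j⟩ ⟨x, ⟨⟨h1, h2⟩, h3, h4⟩, hx⟩
  have := hR hx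
  rw [mem_closedBall, dist_zero_right, Prod.norm_def, max_le_iff, Real.norm_eq_abs, Real.norm_eq_abs,
    abs_le, abs_le] at this
  have hc := Int.le_ceil R
  obtain ⟨⟨a, b⟩, a', b'⟩ := this
  simp only at h1 h2 h3 h4
  simp only [mem_prod, mem_Icc]
  refine ⟨⟨?_, ?_⟩, ?_, ?_⟩ <;> rify <;> linarith

noncomputable def toR (v : V) : ℝ × ℝ := ((v.1 : ℝ), (v.2 : ℝ))

noncomputable def pt (u v : V) (t : ℝ) : ℝ × ℝ := toR u + t • (toR v - toR u)

lemma Joins_cases (e : E) (u v : V) (h : Joins e u v) :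
    v = (u.1 + 1, u.2) ∧ e = (u, false) ∨ v = (u.1 - 1, u.2) ∧ e = (v, false) ∨
    v = (u.1, u.2 + 1) ∧ e = (u, true) ∨ v = (u.1, u.2 - 1) ∧ e = (v, true) := by
  obtain ⟨⟨a, b⟩, t⟩ := e
  obtain ⟨u1, u2⟩ := u
  obtain ⟨v1, v2⟩ := v
  cases t <;> simp only [Joins, dst, Prod.mk.injEq, if_true, Bool.false_eq_true, if_false, reduceCtorEq, and_true, and_false] at h ⊢ <;> omega

lemma mem_seg_hor (i j : ℤ) (x : ℝ × ℝ) :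
    x ∈ seg ((i, j), false) ↔ ((i : ℝ) ≤ x.1 ∧ x.1 ≤ i + 1) ∧ x.2 = j := by
  simp only [seg, cell, opp, Bool.false_eq_true, if_false, mem_inter_iff, mem_ofPred_eq]
  push_cast
  constructor
  · rintro ⟨⟨h1, h2, h3⟩, h4, h5, h6⟩
    exact ⟨h1, by linarith⟩
  · rintro ⟨h1, h2⟩
    rw [h2]
    exact ⟨⟨h1, by linarith, by linarith⟩, h1, by linarith, by linarith⟩

lemma mem_seg_vert (i j : ℤ) (x : ℝ × ℝ) :
    x ∈ seg ((i, j), true) ↔ x.1 = i ∧ ((j : ℝ) ≤ x.2 ∧ x.2 ≤ j + 1) := by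
  simp only [seg, cell, opp, if_true, mem_inter_iff, mem_ofPred_eq]
  push_cast
  constructor
  · rintro ⟨⟨⟨h2, h3⟩, h1⟩, ⟨h5, h6⟩, h4⟩
    exact ⟨by linarith, h1⟩
  · rintro ⟨h2, h1⟩
    rw [h2]
    exact ⟨⟨⟨by linarith, by linarith⟩, h1⟩, ⟨by linarith, by linarith⟩, h1⟩

lemma pt_fst (u v : V) (t : ℝ) : (pt u v t).1 = u.1 + t * (v.1 - u.1) := rfl
lemma pt_snd (u v : V) (t : ℝ) : (pt u v t).2 = u.2 + t * (v.2 - u.2) := rfl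

lemma pt_mem_seg (e : E) (u v : V) (h : Joins e u v) (t : ℝ) (h0 : 0 ≤ t) (h1 : t ≤ 1) :
    pt u v t ∈ seg e := by
  obtain ⟨u1, u2⟩ := u
  rcases Joins_cases e _ v h with ⟨rfl, rfl⟩ | ⟨rfl, rfl⟩ | ⟨rfl, rfl⟩ | ⟨rfl, rfl⟩ <;>
  simp only [mem_seg_hor, mem_seg_vert, pt_fst, pt_snd] <;> push_cast <;>
  refine ⟨?_, ?_⟩ <;> first | (constructor <;> linarith) | linarith

lemma seg_pt (e : E) (u v : V) (h : Joins e u v) (x : ℝ × ℝ) (hx : x ∈ seg e) :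
    ∃ t, 0 ≤ t ∧ t ≤ 1 ∧ pt u v t = x := by
  obtain ⟨u1, u2⟩ := u
  obtain ⟨x1, x2⟩ := x
  rcases Joins_cases e _ v h with ⟨rfl, rfl⟩ | ⟨rfl, rfl⟩ | ⟨rfl, rfl⟩ | ⟨rfl, rfl⟩ <;>
  simp only [mem_seg_hor, mem_seg_vert] at hx <;> push_cast at hx
  · refine ⟨x1 - u1, by linarith, by linarith, Prod.ext ?_ ?_⟩ <;>
    simp only [pt_fst, pt_snd] <;> push_cast <;> linarith
  · refine ⟨u1 - x1, by linarith, by linarith, Prod.ext ?_ ?_⟩ <;>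
    simp only [pt_fst, pt_snd] <;> push_cast <;> linarith
  · refine ⟨x2 - u2, by linarith, by linarith, Prod.ext ?_ ?_⟩ <;>
    simp only [pt_fst, pt_snd] <;> push_cast <;> linarith
  · refine ⟨u2 - x2, by linarith, by linarith, Prod.ext ?_ ?_⟩ <;>
    simp only [pt_fst, pt_snd] <;> push_cast <;> linarith

lemma int_pp (a b : ℤ) (t s : ℝ) (ht : 0 ≤ t) (ht' : t < 1) (hs : 0 ≤ s) (hs' : s < 1)
    (h : (a : ℝ) + t = b + s) : a = b ∧ t = s := by
  have h1 : (a : ℝ) < (b + 1 : ℤ) := by push_cast; linarith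
  have h2 : (b : ℝ) < (a + 1 : ℤ) := by push_cast; linarith
  have h1 := Int.cast_lt.1 h1
  have h2 := Int.cast_lt.1 h2
  have : a = b := by omega
  subst this
  exact ⟨rfl, by linarith⟩

lemma int_pm (a b : ℤ) (t s : ℝ) (ht : 0 ≤ t) (ht' : t < 1) (hs : 0 ≤ s) (hs' : s < 1)
    (h : (a : ℝ) + t = b - s) : (a = b ∧ t = 0 ∧ s = 0) ∨ b = a + 1 := by
  have h1 : (a : ℝ) ≤ (b : ℤ) := by linarith
  have h2 : (b : ℝ) < (a + 2 : ℤ) := by push_cast; linarith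
  have h1 := Int.cast_le.1 h1
  have h2 := Int.cast_lt.1 h2
  by_cases hab : a = b
  · subst hab
    exact Or.inl ⟨rfl, by linarith, by linarith⟩
  · right; omega

lemma pt_inj (e e' : E) (u v u' v' : V) (h : Joins e u v) (h' : Joins e' u' v') (t s : ℝ)
    (ht : 0 ≤ t) (ht' : t < 1) (hs : 0 ≤ s) (hs' : s < 1) (heq : pt u v t = pt u' v' s) :
    (u = u' ∧ t = s) ∨ (u = v' ∧ v = u') := by
  obtain ⟨a, b⟩ := u
  obtain ⟨c, d⟩ := u'
  have e1 := congrArg Prod.fst heq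
  have e2 := congrArg Prod.snd heq
  simp only [pt_fst, pt_snd] at e1 e2
  have z0 : (0:ℝ) ≤ 0 := le_rfl
  have z1 : (0:ℝ) < 1 := one_pos
  rcases Joins_cases e _ v h with ⟨rfl, -⟩ | ⟨rfl, -⟩ | ⟨rfl, -⟩ | ⟨rfl, -⟩ <;>
  rcases Joins_cases e' _ v' h' with ⟨rfl, -⟩ | ⟨rfl, -⟩ | ⟨rfl, -⟩ | ⟨rfl, -⟩ <;>
  push_cast at e1 e2 <;> simp only [Prod.mk.injEq]
  · have := int_pp a c t s ht ht' hs hs' (by linarith)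
    have := int_pp b d 0 0 z0 z1 z0 z1 (by linarith)
    tauto
  · have := int_pm a c t s ht ht' hs hs' (by linarith)
    have := int_pp b d 0 0 z0 z1 z0 z1 (by linarith)
    rcases int_pm a c t s ht ht' hs hs' (by linarith) with ⟨h1, h2, h3⟩ | h1
    · left; exact ⟨⟨h1, this.1⟩, by rw [h2, h3]⟩
    · right; omega
  · have h1 := int_pp a c t 0 ht ht' z0 z1 (by linarith)
    have h2 := int_pp b d 0 s z0 z1 hs hs' (by linarith)
    exact Or.inl ⟨⟨h1.1, h2.1⟩, by linarith⟩
  · have h1 := int_pp a c t 0 ht ht' z0 z1 (by linarith)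
    have h2 := int_pp d b 0 s z0 z1 hs hs' (by linarith)
    exact Or.inl ⟨⟨h1.1, h2.1.symm⟩, by linarith⟩
  · have := int_pp b d 0 0 z0 z1 z0 z1 (by linarith)
    rcases int_pm c a s t hs hs' ht ht' (by linarith) with ⟨h1, h2, h3⟩ | h1
    · left; exact ⟨⟨h1.symm, this.1⟩, by rw [h2, h3]⟩
    · right; omega
  · have h1 := int_pp a c s t hs hs' ht ht' (by linarith)
    have := int_pp b d 0 0 z0 z1 z0 z1 (by linarith)
    exact Or.inl ⟨⟨h1.1, this.1⟩, by linarith⟩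
  · have h1 := int_pp c a t 0 ht ht' z0 z1 (by linarith)
    have h2 := int_pp b d 0 s z0 z1 hs hs' (by linarith)
    exact Or.inl ⟨⟨h1.1.symm, h2.1⟩, by linarith⟩
  · have h1 := int_pp c a t 0 ht ht' z0 z1 (by linarith)
    have h2 := int_pp d b 0 s z0 z1 hs hs' (by linarith)
    exact Or.inl ⟨⟨h1.1.symm, h2.1.symm⟩, by linarith⟩
  · have h1 := int_pp a c 0 s z0 z1 hs hs' (by linarith)
    have h2 := int_pp b d t 0 ht ht' z0 z1 (by linarith)
    exact Or.inl ⟨⟨h1.1, h2.1⟩, by linarith⟩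
  · have h1 := int_pp c a 0 s z0 z1 hs hs' (by linarith)
    have h2 := int_pp b d t 0 ht ht' z0 z1 (by linarith)
    exact Or.inl ⟨⟨h1.1.symm, h2.1⟩, by linarith⟩
  · have := int_pp b d t s ht ht' hs hs' (by linarith)
    have := int_pp a c 0 0 z0 z1 z0 z1 (by linarith)
    tauto
  · have := int_pp a c 0 0 z0 z1 z0 z1 (by linarith)
    rcases int_pm b d t s ht ht' hs hs' (by linarith) with ⟨h1, h2, h3⟩ | h1
    · left; exact ⟨⟨this.1, h1⟩, by rw [h2, h3]⟩
    · right; omega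
  · have h1 := int_pp a c 0 s z0 z1 hs hs' (by linarith)
    have h2 := int_pp d b t 0 ht ht' z0 z1 (by linarith)
    exact Or.inl ⟨⟨h1.1, h2.1.symm⟩, by linarith⟩
  · have h1 := int_pp c a 0 s z0 z1 hs hs' (by linarith)
    have h2 := int_pp d b t 0 ht ht' z0 z1 (by linarith)
    exact Or.inl ⟨⟨h1.1.symm, h2.1.symm⟩, by linarith⟩
  · have := int_pp a c 0 0 z0 z1 z0 z1 (by linarith)
    rcases int_pm d b s t hs hs' ht ht' (by linarith) with ⟨h1, h2, h3⟩ | h1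
    · left; exact ⟨⟨this.1, h1.symm⟩, by rw [h2, h3]⟩
    · right; omega
  · have h1 := int_pp b d s t hs hs' ht ht' (by linarith)
    have := int_pp a c 0 0 z0 z1 z0 z1 (by linarith)
    exact Or.inl ⟨⟨this.1, h1.1⟩, by linarith⟩

lemma smooth_inj (x y : ℝ) (hx : 0 ≤ x) (hy : y ≤ 1) (hxy : x < y) :
    Real.smoothTransition x < Real.smoothTransition y := by
  have hlt : expNegInvGlue x < expNegInvGlue y := by
    rcases hx.eq_or_lt with rfl | hx
    · rw [expNegInvGlue.zero]; exact expNegInvGlue.pos_of_pos hxy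
    · have hy0 : 0 < y := hx.trans hxy
      simp only [expNegInvGlue, not_le.2 hx, not_le.2 hy0, if_false]
      apply Real.exp_lt_exp.2
      have := inv_strictAnti₀ hx hxy
      linarith
  have h1 : expNegInvGlue (1 - y) ≤ expNegInvGlue (1 - x) := expNegInvGlue.monotone (by linarith)
  have h2 : 0 < expNegInvGlue (1 - x) := expNegInvGlue.pos_of_pos (by linarith)
  have h3 := expNegInvGlue.nonneg x
  unfold Real.smoothTransition
  rw [div_lt_div_iff₀ (Real.smoothTransition.pos_denom x) (Real.smoothTransition.pos_denom y)]
  nlinarith [mul_le_mul_of_nonneg_left h1 h3, mul_lt_mul_of_pos_right hlt h2]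

noncomputable def L (P : ℤ → V) (s : ℝ) : ℝ × ℝ :=
  pt (P ⌊s⌋) (P (⌊s⌋ + 1)) (Real.smoothTransition (Int.fract s))

lemma L_contDiff (P : ℤ → V) : ContDiff ℝ 1 (L P) := by
  rw [contDiff_iff_contDiffAt]
  intro s0
  set k := ⌊s0⌋ with hk
  have hτ : ContDiff ℝ 1 Real.smoothTransition := Real.smoothTransition.contDiff (n := 1)
  have hF : ContDiff ℝ 1 (fun s : ℝ => toR (P (k - 1)) +
      Real.smoothTransition (s - (k - 1)) • (toR (P k) - toR (P (k - 1))) +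
      Real.smoothTransition (s - k) • (toR (P (k + 1)) - toR (P k))) := by
    have h1 : ContDiff ℝ 1 (fun s : ℝ => Real.smoothTransition (s - (k - 1))) :=
      hτ.comp (contDiff_id.sub contDiff_const)
    have h2 : ContDiff ℝ 1 (fun s : ℝ => Real.smoothTransition (s - k)) :=
      hτ.comp (contDiff_id.sub contDiff_const)
    exact (contDiff_const.add (h1.smul contDiff_const)).add (h2.smul contDiff_const)
  refine hF.contDiffAt.congr_of_eventuallyEq ?_
  have hl : (k : ℝ) - 1 < s0 := by have := Int.floor_le s0; linarith
  have hr : s0 < k + 1 := Int.lt_floor_add_one s0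
  filter_upwards [lt_mem_nhds hl, gt_mem_nhds hr] with s h1 h2
  by_cases hs : s < k
  · have hfl : ⌊s⌋ = k - 1 := Int.floor_eq_iff.2 ⟨by push_cast; linarith, by push_cast; linarith⟩
    rw [Real.smoothTransition.zero_of_nonpos (x := s - k) (by linarith)]
    simp only [L, pt, Int.fract, hfl]
    push_cast
    simp
  · have hfl : ⌊s⌋ = k := Int.floor_eq_iff.2 ⟨by linarith, by linarith⟩
    rw [Real.smoothTransition.one_of_one_le (x := s - (k - 1)) (by linarith)]
    simp only [L, pt, Int.fract, hfl]
    simp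

lemma fract_smooth (s : ℝ) : 0 ≤ Real.smoothTransition (Int.fract s) ∧
    Real.smoothTransition (Int.fract s) < 1 :=
  ⟨Real.smoothTransition.nonneg _, Real.smoothTransition.lt_one_of_lt_one (Int.fract_lt_one s)⟩

lemma L_surj (P : ℤ → V) (k : ℤ) (t : ℝ) (h0 : 0 ≤ t) (h1 : t ≤ 1) :
    ∃ s, L P s = pt (P k) (P (k + 1)) t := by
  rcases h1.eq_or_lt with rfl | h1
  · exact ⟨((k + 1 : ℤ) : ℝ), by
      simp only [L, Int.floor_intCast, Int.fract_intCast, Real.smoothTransition.zero, pt]; simp⟩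
  · have := intermediate_value_Icc (zero_le_one (α := ℝ))
      Real.smoothTransition.continuous.continuousOn
    rw [Real.smoothTransition.zero, Real.smoothTransition.one] at this
    obtain ⟨x, ⟨hx0, hx1⟩, hx⟩ := this ⟨h0, h1.le⟩
    have hx1 : x < 1 := by
      rcases hx1.eq_or_lt with rfl | h
      · rw [Real.smoothTransition.one] at hx; linarith
      · exact h
    refine ⟨k + x, ?_⟩
    have hfl : ⌊(k : ℝ) + x⌋ = k := Int.floor_eq_iff.2 ⟨by linarith, by linarith⟩
    simp only [L, Int.fract, hfl, add_sub_cancel_left, hx]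

lemma L_inj (P : ℤ → V) (n : ℕ) (hn : 3 ≤ n)
    (hinj : ∀ a b, P a = P b → (n : ℤ) ∣ a - b) (hadj : ∀ k, ∃ e, Joins e (P k) (P (k + 1)))
    (s s' : ℝ) (h0 : 0 ≤ s) (h1 : s < n) (h0' : 0 ≤ s') (h1' : s' < n) (h : L P s = L P s') :
    s = s' := by
  obtain ⟨e, he⟩ := hadj ⌊s⌋
  obtain ⟨e', he'⟩ := hadj ⌊s'⌋
  have b0 : 0 ≤ ⌊s⌋ := Int.floor_nonneg.2 h0
  have b0' : 0 ≤ ⌊s'⌋ := Int.floor_nonneg.2 h0'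
  have b1 : ⌊s⌋ < n := Int.floor_lt.2 (by exact_mod_cast h1)
  have b1' : ⌊s'⌋ < n := Int.floor_lt.2 (by exact_mod_cast h1')
  rcases pt_inj e e' _ _ _ _ he he' _ _ (fract_smooth s).1 (fract_smooth s).2 (fract_smooth s').1
    (fract_smooth s').2 h with ⟨hu, ht⟩ | ⟨hu, hv⟩
  · have hfl : ⌊s⌋ = ⌊s'⌋ := by
      have := Int.eq_zero_of_abs_lt_dvd (hinj _ _ hu) (by rw [abs_lt]; omega)
      omega
    have hfr : Int.fract s = Int.fract s' := by
      by_contra hne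
      rcases lt_or_gt_of_ne hne with h | h
      · exact (smooth_inj _ _ (Int.fract_nonneg _) (Int.fract_lt_one _).le h).ne ht
      · exact (smooth_inj _ _ (Int.fract_nonneg _) (Int.fract_lt_one _).le h).ne' ht
    rw [← Int.floor_add_fract s, ← Int.floor_add_fract s', hfl, hfr]
  · exfalso
    have h1 := hinj _ _ hu
    have h2 := hinj _ _ hv
    have h3 := dvd_sub h2 h1
    rw [show ⌊s⌋ + 1 - ⌊s'⌋ - (⌊s⌋ - (⌊s'⌋ + 1)) = 2 by ring] at h3
    have := Int.le_of_dvd (by norm_num) h3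
    omega

/-- the unit-scale statement -/
lemma unit_curve (Γ : Set (ℝ × ℝ)) (hb : Bornology.IsBounded Γ) (x0 : ℝ × ℝ) (hx0 : x0 ∈ Γ) :
    ∃ (θ : ℝ → ℝ × ℝ) (A : Set (ℝ × ℝ)), ContDiff ℝ 1 θ ∧ Function.Periodic θ 1 ∧
      InjOn θ (Ico (0:ℝ) 1) ∧ (∀ s, θ s ∉ Γ ∧ ∃ γ ∈ Γ, dist (θ s) γ ≤ 1) ∧
      Bornology.IsBounded A ∧ x0 ∈ A ∧ frontier A ⊆ range θ := by
  classical
  let f : V → ZMod 2 := fun c => if (cell c ∩ Γ).Nonempty then 1 else 0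
  have hf : ∀ c, f c ≠ 0 ↔ (cell c ∩ Γ).Nonempty := fun c => by
    simp only [f]; split_ifs with h <;> simp [h]
  have hfin : {c | f c ≠ 0}.Finite := by
    simp only [hf]; exact cells_finite Γ hb
  obtain ⟨n, p, g, hn, hp, hinj, hadj, hgf, hgc, hgC⟩ :=
    exists_enclosing _ f hfin (⌊x0.1⌋, ⌊x0.2⌋) ((hf _).2 ⟨x0, mem_cell_floor x0, hx0⟩) le_rfl
  have hn0 : (n : ℤ) ≠ 0 := by omega
  let P : ℤ → V := fun k => p (k % n).toNat
  have hmod : ∀ k : ℤ, (k % n).toNat < n ∧ ((k % n).toNat : ℤ) = k % n := fun k => by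
    have h1 := Int.emod_nonneg k hn0
    have h2 := Int.emod_lt_of_pos k (by omega : (0:ℤ) < n)
    omega
  have hPadj : ∀ k, Adj f (P k) (P (k + 1)) := fun k => by
    have h := hadj (k % n).toNat
    have he : p ((k % n).toNat + 1) = P (k + 1) := by
      simp only [P]
      obtain ⟨h1, h2⟩ := hmod k
      have h3 : (k + 1) % (n : ℤ) = (((k % n).toNat : ℤ) + 1) % n := by rw [h2, Int.emod_add_emod]
      rw [h3]
      generalize (k % n).toNat = m at *
      by_cases hm : m + 1 = n
      · have : (m : ℤ) + 1 = n := by exact_mod_cast hm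
        rw [hm, hp, this, Int.emod_self]
        rfl
      · rw [Int.emod_eq_of_lt (by omega) (by omega)]
        rfl
    rw [← he]
    exact h
  have hPinj : ∀ a b, P a = P b → (n : ℤ) ∣ a - b := fun a b hab => by
    have := hinj _ (hmod a).1 _ (hmod b).1 hab
    apply Int.ModEq.dvd
    show b % n = a % n
    rw [← (hmod a).2, ← (hmod b).2, this]
  have hPper : ∀ k, P (k + n) = P k := fun k => by simp only [P, Int.add_emod_right]
  have hPp : ∀ k < n, P k = p k := fun k hk => by
    simp only [P]; congr 1
    rw [Int.emod_eq_of_lt (by omega) (by omega)]; simp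
  have hPp' : ∀ k < n, P (k + 1) = p (k + 1) := fun k hk => by
    by_cases h : k + 1 < n
    · exact_mod_cast hPp (k + 1) h
    · have : k + 1 = n := by omega
      have h2 : (k : ℤ) + 1 = 0 + n := by omega
      rw [this, hp, h2, hPper]
      exact hPp 0 (by omega)
  have hnR : (0 : ℝ) < n := by exact_mod_cast (by omega : 0 < n)
  refine ⟨fun t => L P (n * t), ⋃ c ∈ {c | g c ≠ 0}, cell c, ?_, ?_, ?_, ?_, ?_, ?_, ?_⟩
  · exact (L_contDiff P).comp (contDiff_const.mul contDiff_id)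
  · intro t
    have : (n : ℝ) * (t + 1) = n * t + (n : ℤ) := by push_cast; ring
    simp only [this, L, Int.floor_add_intCast, Int.fract_add_intCast, hPper,
      add_right_comm _ (n : ℤ) 1]
  · rintro s ⟨h0, h1⟩ s' ⟨h0', h1'⟩ h
    have := L_inj P n hn hPinj (fun k => let ⟨e, _, h⟩ := hPadj k; ⟨e, h⟩) _ _
      (by positivity) (by nlinarith) (by positivity) (by nlinarith) h
    exact mul_left_cancel₀ hnR.ne' this
  · intro t
    simp only [L]
    set s := (n : ℝ) * t
    obtain ⟨e, he, hj⟩ := hPadj ⌊s⌋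
    have hseg := pt_mem_seg e _ _ hj _ (fract_smooth s).1 (fract_smooth s).2.le
    set x := pt (P ⌊s⌋) (P (⌊s⌋ + 1)) (Real.smoothTransition (Int.fract s))
    have key : ∀ c c' : V, x ∈ cell c → x ∈ cell c' → f c ≠ 0 → f c' = 0 →
        x ∉ Γ ∧ ∃ γ ∈ Γ, dist x γ ≤ 1 := fun c c' hc hc' h1 h2 => by
      constructor
      · intro hx
        exact (hf c').2 ⟨x, hc', hx⟩ h2
      · obtain ⟨γ, hγ, hγΓ⟩ := (hf c).1 h1
        exact ⟨γ, hγΓ, dist_cell c _ _ hc hγ⟩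
    have h01 : ∀ a b : ZMod 2, a + b ≠ 0 → (a ≠ 0 ∧ b = 0) ∨ (b ≠ 0 ∧ a = 0) := by decide
    rcases h01 _ _ he with ⟨h1, h2⟩ | ⟨h1, h2⟩
    · exact key _ _ hseg.1 hseg.2 h1 h2
    · exact key _ _ hseg.2 hseg.1 h1 h2
  · exact (Bornology.isBounded_biUnion hgf).2 fun c _ => isBounded_cell c
  · simp only [mem_iUnion]
    exact ⟨_, hgc, mem_cell_floor x0⟩
  · intro x hx
    obtain ⟨e, he, hxe⟩ := frontier_sub g hgf hx
    obtain ⟨k, hk, hj⟩ := hgC e he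
    rw [← hPp k hk, ← hPp' k hk] at hj
    obtain ⟨t, h0, h1, rfl⟩ := seg_pt e _ _ hj x hxe
    obtain ⟨s, hs⟩ := L_surj P k t h0 h1
    refine ⟨s / n, ?_⟩
    simp only
    rw [mul_div_cancel₀ _ hnR.ne', hs]

end JC

/-- **Enclosing a non-disconnecting compact connected set by a nearby C¹ Jordan curve.**
Let `Γ` be a compact connected subset of the open unit square whose complement in the square
is connected.  Then for every `ε > 0` there is a `C¹`, closed (`1`-periodic), injective
(on a period) curve `θ` inside the open square, whose every point is at distance `< ε`
from `Γ`, such that `Γ` is contained in the bounded connected component of the complement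
of the curve (its internal part). -/
theorem exists_C1_jordan_curve_around (Γ : Set (ℝ × ℝ))
    (hΓcpt : IsCompact Γ) (hΓconn : IsConnected Γ) (hΓsub : Γ ⊆ interior Qsq)
    (hcompl : IsConnected (Qsq \ Γ)) (ε : ℝ) (hε : 0 < ε) :
    ∃ θ : ℝ → ℝ × ℝ, ContDiff ℝ 1 θ ∧ Function.Periodic θ 1 ∧
      InjOn θ (Ico (0:ℝ) 1) ∧ range θ ⊆ interior Qsq ∧
      (∀ s : ℝ, infDist (θ s) Γ < ε) ∧
      ∃ x₀ ∈ Γ, Γ ⊆ connectedComponentIn (range θ)ᶜ x₀ ∧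
        Bornology.IsBounded (connectedComponentIn (range θ)ᶜ x₀) := by
  obtain ⟨δ, hδ, hsub⟩ := hΓcpt.exists_thickening_subset_open isOpen_interior hΓsub
  obtain ⟨x₀, hx₀⟩ := hΓconn.nonempty
  -- the scale
  set h : ℝ := min δ ε / 2 with hh
  have hpos : 0 < h := by positivity
  have hhδ : h < δ := by have := min_le_left δ ε; have := lt_min hδ hε; linarith
  have hhε : h < ε := by have := min_le_right δ ε; have := lt_min hδ hε; linarith
  let φ : (ℝ × ℝ) ≃ₜ (ℝ × ℝ) := Homeomorph.smulOfNeZero h hpos.ne'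
  have hφ : ∀ x, φ x = h • x := fun x => rfl
  obtain ⟨θ, A, h1, h2, h3, h4, h5, h6, h7⟩ := JC.unit_curve (φ ⁻¹' Γ)
    ((φ.isCompact_preimage.2 hΓcpt).isBounded) (φ.symm x₀) (by simpa using hx₀)
  have hnear : ∀ s, ∃ γ ∈ Γ, dist (h • θ s) γ ≤ h := fun s => by
    obtain ⟨-, γ, hγ, hd⟩ := h4 s
    refine ⟨h • γ, hγ, ?_⟩
    rw [dist_smul₀, Real.norm_eq_abs, abs_of_pos hpos]
    nlinarith
  have hdisj : Γ ⊆ (range fun s => h • θ s)ᶜ := by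
    rintro x hx ⟨s, rfl⟩
    exact (h4 s).1 hx
  have hbd : Bornology.IsBounded (φ '' A) := by
    have := h5.smul₀ h
    exact this
  have hfr : frontier (φ '' A) ⊆ range fun s => h • θ s := by
    rw [← φ.image_frontier]
    rintro _ ⟨x, hx, rfl⟩
    obtain ⟨s, rfl⟩ := h7 hx
    exact ⟨s, rfl⟩
  refine ⟨fun s => h • θ s, h1.const_smul h, fun s => by simp only [h2 s], ?_, ?_, ?_,
    x₀, hx₀, hΓconn.isPreconnected.subset_connectedComponentIn hx₀ hdisj, ?_⟩
  · intro s hs s' hs' he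
    exact h3 hs hs' (smul_right_injective _ hpos.ne' he)
  · rintro _ ⟨s, rfl⟩
    obtain ⟨γ, hγ, hd⟩ := hnear s
    exact hsub (mem_thickening_iff.2 ⟨γ, hγ, by linarith⟩)
  · intro s
    obtain ⟨γ, hγ, hd⟩ := hnear s
    exact (infDist_le_dist_of_mem hγ).trans_lt (by linarith)
  · set C := connectedComponentIn (range fun s => h • θ s)ᶜ x₀ with hC
    have hCsub : C ⊆ (range fun s => h • θ s)ᶜ := connectedComponentIn_subset _ _
    have hx₀C : x₀ ∈ C := mem_connectedComponentIn (hdisj hx₀)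
    have hx₀A : x₀ ∈ φ '' A := ⟨_, h6, by simp⟩
    have hnf : ∀ x ∈ C, x ∉ frontier (φ '' A) := fun x hx hf => hCsub hx (hfr hf)
    have hint : ∀ x ∈ C, x ∈ closure (φ '' A) → x ∈ interior (φ '' A) := fun x hx hcl => by
      by_contra hni
      exact hnf x hx ⟨hcl, hni⟩
    have : C ⊆ interior (φ '' A) := by
      refine isPreconnected_connectedComponentIn.subset_left_of_subset_union isOpen_interior
        (isClosed_closure.isOpen_compl (X := ℝ × ℝ) (s := closure (φ '' A))) ?_ ?_ ?_
      · exact disjoint_compl_right.mono_left (interior_subset.trans subset_closure)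
      · intro x hx
        by_cases hcl : x ∈ closure (φ '' A)
        · exact Or.inl (hint x hx hcl)
        · exact Or.inr hcl
      · exact ⟨x₀, hx₀C, hint x₀ hx₀C (subset_closure hx₀A)⟩
    exact hbd.subset (this.trans interior_subset)
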